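/- arXiv:1009.6143 — 2 statements merged into one kernel-verified Lean document; each statement's English description precedes it below -/
import Mathlib

section
/- For every real number k ≥ 0, all points x ≠ y in ℝ³ with r = |x−y|, and all indices i,j ∈ {1,2,3}, the second partial derivatives of g(x,y) = e^{ikr}/(4πr) in the x variable satisfy |∂²g/∂xᵢ∂xⱼ (x,y)| ≤ (4 + 4kr + k²r²)/(4πr³). -/
noncomputable section

open MeasureTheory Filter
open scoped BigOperators Topology

/-- Points of physical space, `ℝ³` with the Euclidean norm. -/
abbrev R3 := EuclideanSpace ℝ (Fin 3)

/-- The partial derivative `∂f/∂xᵢ` of a complex-valued function on `ℝ³`. -/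
def pd (i : Fin 3) (f : R3 → ℂ) : R3 → ℂ :=
  fun x => fderiv ℝ f x (EuclideanSpace.single i (1 : ℝ))

/-- The outgoing fundamental solution `g(x,y) = e^{ik|x-y|}/(4π|x-y|)`
of the Helmholtz equation. -/
def g (k : ℝ) (x y : R3) : ℂ :=
  Complex.exp (Complex.I * (k : ℂ) * (‖x - y‖ : ℂ)) / (4 * (Real.pi : ℂ) * (‖x - y‖ : ℂ))

/-- The derivative of the Euclidean distance to `y`, away from `y`. -/
theorem hasFDerivAt_norm_sub {x y : R3} (hxy : x ≠ y) :
    HasFDerivAt (fun x' : R3 => ‖x' - y‖) (‖x - y‖⁻¹ • innerSL ℝ (x - y)) x := by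
  have hr : ‖x - y‖ ≠ 0 := norm_ne_zero_iff.mpr (sub_ne_zero.mpr hxy)
  have h := ((hasFDerivAt_id (𝕜 := ℝ) x).sub_const y).norm_sq.sqrt (pow_ne_zero 2 hr)
  simp only [id, Real.sqrt_sq (norm_nonneg _)] at h
  refine h.congr_fderiv ?_
  ext v
  simp
  field_simp

/-- The Fréchet derivative of a radial function. -/
theorem hasFDerivAt_radial {F : ℝ → ℂ} {F' : ℂ} {x y : R3} (hxy : x ≠ y)
    (hF : HasDerivAt F F' ‖x - y‖) :
    HasFDerivAt (fun x' : R3 => F ‖x' - y‖)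
      ((ContinuousLinearMap.toSpanSingleton ℝ F').comp (‖x - y‖⁻¹ • innerSL ℝ (x - y))) x :=
  hF.hasFDerivAt.comp x (hasFDerivAt_norm_sub hxy)

theorem pd_radial {F : ℝ → ℂ} {F' : ℂ} {x y : R3} (hxy : x ≠ y)
    (hF : HasDerivAt F F' ‖x - y‖) (i : Fin 3) :
    pd i (fun x' => F ‖x' - y‖) x = F' / (‖x - y‖ : ℂ) * ((x - y) i : ℂ) := by
  rw [pd, (hasFDerivAt_radial hxy hF).fderiv]
  simp [EuclideanSpace.inner_single_right]
  ring

theorem pd_radial_mul_coord {F : ℝ → ℂ} {F' : ℂ} {x y : R3} (hxy : x ≠ y)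
    (hF : HasDerivAt F F' ‖x - y‖) (i j : Fin 3) :
    pd i (fun x' => F ‖x' - y‖ * ((x' - y) j : ℂ)) x =
      F' / (‖x - y‖ : ℂ) * ((x - y) i : ℂ) * ((x - y) j : ℂ)
        + F ‖x - y‖ * (if i = j then 1 else 0) := by
  have h1 := hasFDerivAt_radial hxy hF
  have h2 : HasFDerivAt (fun x' : R3 => (((x' - y) j : ℝ) : ℂ))
      (Complex.ofRealCLM.comp (EuclideanSpace.proj (𝕜 := ℝ) j)) x :=
    (Complex.ofRealCLM.comp (EuclideanSpace.proj (𝕜 := ℝ) j)).hasFDerivAt.comp x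
      ((hasFDerivAt_id (𝕜 := ℝ) x).sub_const y)
  have h := (h1.mul h2).fderiv
  change fderiv ℝ ((fun x' : R3 => F ‖x' - y‖) * fun x' : R3 => (((x' - y) j : ℝ) : ℂ)) x _ = _
  rw [h]
  by_cases hij : i = j
  · subst hij
    simp [EuclideanSpace.inner_single_right]
    ring
  · simp [EuclideanSpace.inner_single_right, hij, Ne.symm hij]
    ring

theorem hasDerivAt_exp_I_mul (k r : ℝ) :
    HasDerivAt (fun s : ℝ => Complex.exp (Complex.I * k * s))
      (Complex.exp (Complex.I * k * r) * (Complex.I * k)) r := by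
  have h : HasDerivAt (fun s : ℝ => Complex.I * k * (s : ℂ)) (Complex.I * k) r := by
    simpa using (hasDerivAt_id r).ofReal_comp.const_mul (Complex.I * (k : ℂ))
  exact h.cexp

theorem hasDerivAt_spherical_wave (k : ℝ) {r : ℝ} (hr : r ≠ 0) :
    HasDerivAt (fun s : ℝ => Complex.exp (Complex.I * k * s) / (4 * (Real.pi : ℂ) * s))
      (Complex.exp (Complex.I * k * r) * (Complex.I * k * r - 1) / (4 * (Real.pi : ℂ) * r ^ 2))
      r := by
  have hs : HasDerivAt (fun s : ℝ => (s : ℂ)) 1 r := by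
    simpa using (hasDerivAt_id r).ofReal_comp
  have hpi : (Real.pi : ℂ) ≠ 0 := by exact_mod_cast Real.pi_ne_zero
  have hr' : (r : ℂ) ≠ 0 := by exact_mod_cast hr
  refine HasDerivAt.congr_deriv ((hasDerivAt_exp_I_mul k r).fun_div (hs.const_mul (4 * (Real.pi : ℂ)))
    (by simp [hr, Real.pi_ne_zero])) ?_
  field_simp

theorem hasDerivAt_spherical_wave_deriv_div (k : ℝ) {r : ℝ} (hr : r ≠ 0) :
    HasDerivAt (fun s : ℝ => Complex.exp (Complex.I * k * s) * (Complex.I * k * s - 1) /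
        (4 * (Real.pi : ℂ) * s ^ 3))
      (Complex.exp (Complex.I * k * r) * (3 - 3 * Complex.I * k * r - k ^ 2 * r ^ 2) /
        (4 * (Real.pi : ℂ) * r ^ 4)) r := by
  have hs : HasDerivAt (fun s : ℝ => (s : ℂ)) 1 r := by
    simpa using (hasDerivAt_id r).ofReal_comp
  have hpi : (Real.pi : ℂ) ≠ 0 := by exact_mod_cast Real.pi_ne_zero
  have hr' : (r : ℂ) ≠ 0 := by exact_mod_cast hr
  refine HasDerivAt.congr_deriv (((hasDerivAt_exp_I_mul k r).fun_mul
    ((hs.const_mul (Complex.I * (k : ℂ))).sub_const 1)).fun_div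
    ((hs.fun_pow 3).const_mul (4 * (Real.pi : ℂ))) (by simp [hr, Real.pi_ne_zero])) ?_
  field_simp
  ring_nf
  simp only [Complex.I_sq]
  ring

theorem pd_g {k : ℝ} {x y : R3} (hxy : x ≠ y) (j : Fin 3) :
    pd j (fun x' => g k x' y) x =
      Complex.exp (Complex.I * k * ‖x - y‖) * (Complex.I * k * ‖x - y‖ - 1) /
        (4 * (Real.pi : ℂ) * ‖x - y‖ ^ 3) * ((x - y) j : ℂ) := by
  have hr : ‖x - y‖ ≠ 0 := norm_ne_zero_iff.mpr (sub_ne_zero.mpr hxy)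
  have hr' : (‖x - y‖ : ℂ) ≠ 0 := by exact_mod_cast hr
  refine (pd_radial hxy (hasDerivAt_spherical_wave k hr) j).trans ?_
  have hpi : (Real.pi : ℂ) ≠ 0 := by exact_mod_cast Real.pi_ne_zero
  field_simp

theorem pd_pd_g {k : ℝ} {x y : R3} (hxy : x ≠ y) (i j : Fin 3) :
    pd i (pd j (fun x' => g k x' y)) x =
      Complex.exp (Complex.I * k * ‖x - y‖) / (4 * (Real.pi : ℂ) * ‖x - y‖ ^ 3) *
        ((3 - 3 * Complex.I * k * ‖x - y‖ - k ^ 2 * ‖x - y‖ ^ 2) *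
          (((x - y) i / ‖x - y‖ : ℝ) * ((x - y) j / ‖x - y‖ : ℝ))
          + (Complex.I * k * ‖x - y‖ - 1) * (if i = j then 1 else 0)) := by
  have hr : ‖x - y‖ ≠ 0 := norm_ne_zero_iff.mpr (sub_ne_zero.mpr hxy)
  have hr' : (‖x - y‖ : ℂ) ≠ 0 := by exact_mod_cast hr
  have hpi : (Real.pi : ℂ) ≠ 0 := by exact_mod_cast Real.pi_ne_zero
  have hev : pd j (fun x' => g k x' y) =ᶠ[𝓝 x] fun x' =>
      Complex.exp (Complex.I * k * ‖x' - y‖) * (Complex.I * k * ‖x' - y‖ - 1) /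
        (4 * (Real.pi : ℂ) * ‖x' - y‖ ^ 3) * ((x' - y) j : ℂ) := by
    filter_upwards [isOpen_ne.mem_nhds hxy] with x' hx' using pd_g hx' j
  have h := pd_radial_mul_coord hxy (hasDerivAt_spherical_wave_deriv_div k hr) i j
  rw [pd, hev.fderiv_eq]
  refine h.trans ?_
  push_cast
  field_simp

theorem norm_coord_div_norm_le_one (z : R3) (i : Fin 3) : ‖((z i / ‖z‖ : ℝ) : ℂ)‖ ≤ 1 := by
  rw [Complex.norm_real, norm_div, norm_norm]
  exact div_le_one_of_le₀ (PiLp.norm_apply_le z i) (norm_nonneg z)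

/-- for every real `k ≥ 0`, all `x ≠ y` in `ℝ³` with `r = |x−y|`, and all
indices `i, j`, the second partial derivatives of `g(x,y) = e^{ikr}/(4πr)` in the `x`
variable satisfy `|∂²g/∂xᵢ∂xⱼ| ≤ (4 + 4kr + k²r²)/(4πr³)`. -/
theorem second_derivatives_fundamental_solution_bound (k : ℝ) (hk : 0 ≤ k)
    (x y : R3) (hxy : x ≠ y) (i j : Fin 3) :
    ‖pd i (pd j (fun x' => g k x' y)) x‖
      ≤ (4 + 4 * k * ‖x - y‖ + k ^ 2 * ‖x - y‖ ^ 2) / (4 * Real.pi * ‖x - y‖ ^ 3) := by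
  rw [pd_pd_g hxy]
  have hi := norm_coord_div_norm_le_one (x - y) i
  have hj := norm_coord_div_norm_le_one (x - y) j
  have hr : 0 ≤ ‖x - y‖ := norm_nonneg _
  generalize (((x - y) i / ‖x - y‖ : ℝ) : ℂ) = a at *
  generalize (((x - y) j / ‖x - y‖ : ℝ) : ℂ) = b at *
  generalize ‖x - y‖ = r at *
  have hexp : ‖Complex.exp (Complex.I * k * r)‖ = 1 := by
    rw [mul_assoc, mul_comm, ← Complex.ofReal_mul, Complex.norm_exp_ofReal_mul_I]
  have hA : ‖(3 - 3 * Complex.I * k * r - k ^ 2 * r ^ 2 : ℂ)‖ ≤ 3 + 3 * k * r + k ^ 2 * r ^ 2 := by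
    refine (norm_sub_le _ _).trans (add_le_add ((norm_sub_le _ _).trans ?_) ?_) <;>
      simp [abs_of_nonneg hk, abs_of_nonneg hr]
  have hB : ‖(Complex.I * k * r - 1 : ℂ)‖ ≤ k * r + 1 := by
    refine (norm_sub_le _ _).trans ?_
    simp [abs_of_nonneg hk, abs_of_nonneg hr]
  have hδ : ‖(if i = j then 1 else 0 : ℂ)‖ ≤ 1 := by
    split_ifs <;> simp
  have hden : ‖(4 * (Real.pi : ℂ) * r ^ 3)‖ = 4 * Real.pi * r ^ 3 := by
    simp [abs_of_nonneg hr, abs_of_nonneg Real.pi_pos.le]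
  have hab : ‖a * b‖ ≤ 1 := by
    rw [norm_mul]
    exact mul_le_one₀ hi (norm_nonneg _) hj
  rw [norm_mul, norm_div, hexp, hden, one_div_mul_eq_div]
  gcongr
  calc _ ≤ ‖(3 - 3 * Complex.I * k * r - k ^ 2 * r ^ 2 : ℂ)‖ * ‖a * b‖
        + ‖(Complex.I * k * r - 1 : ℂ)‖ * ‖(if i = j then 1 else 0 : ℂ)‖ := by
        rw [← norm_mul, ← norm_mul]
        exact norm_add_le _ _
    _ ≤ (3 + 3 * k * r + k ^ 2 * r ^ 2) * 1 + (k * r + 1) * 1 := by gcongr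
    _ = _ := by ring
end
end

section
/- Let k ≥ 0 be real, let d > 0 and a > 0 with a ≤ d/2, and let x, y, z ∈ ℝ³ satisfy |x−z| ≥ d and |y−z| ≤ a. Then |g(x,y) − g(x,z)| ≤ a·(2/d² + k/d)/(2π), where g(x,y) = e^{ik|x−y|}/(4π|x−y|). In particular, replacing g(x,t) by g(x,x_m) for t on a small body of radius a whose center x_m is at distance at least d from x produces an error of order O(a·max(1/d², k/d)). -/
noncomputable section

open MeasureTheory Filter
open scoped BigOperators Topology

/-- The map `t ↦ e^{ikt}` is `|k|`-Lipschitz. -/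
theorem norm_exp_I_mul_sub_exp_I_mul_le (k r s : ℝ) :
    ‖Complex.exp (Complex.I * (k : ℂ) * (r : ℂ)) - Complex.exp (Complex.I * (k : ℂ) * (s : ℂ))‖
      ≤ |k| * |r - s| := by
  have h : Complex.exp (Complex.I * (k : ℂ) * (r : ℂ)) - Complex.exp (Complex.I * (k : ℂ) * (s : ℂ))
      = Complex.exp (Complex.I * ((k * s : ℝ) : ℂ)) *
        (Complex.exp (Complex.I * ((k * (r - s) : ℝ) : ℂ)) - 1) := by
    rw [mul_sub, ← Complex.exp_add, mul_one]
    push_cast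
    ring_nf
  rw [h, norm_mul, Complex.norm_exp_I_mul_ofReal, one_mul, ← abs_mul]
  exact Real.norm_exp_I_mul_ofReal_sub_one_le

/-- Lipschitz-type estimate for the radial profile `e^{ikt}/t` of the fundamental solution. -/
theorem norm_exp_div_sub_exp_div_le (k : ℝ) {r s : ℝ} (hr : 0 < r) (hs : 0 < s) :
    ‖Complex.exp (Complex.I * (k : ℂ) * (r : ℂ)) / (r : ℂ)
        - Complex.exp (Complex.I * (k : ℂ) * (s : ℂ)) / (s : ℂ)‖
      ≤ |r - s| * (1 / (r * s) + |k| / s) := by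
  have hr' : (r : ℂ) ≠ 0 := by exact_mod_cast hr.ne'
  have hs' : (s : ℂ) ≠ 0 := by exact_mod_cast hs.ne'
  have hunit : ‖Complex.exp (Complex.I * (k : ℂ) * (r : ℂ))‖ = 1 := by
    rw [mul_assoc, ← Complex.ofReal_mul, Complex.norm_exp_I_mul_ofReal]
  have hlip := norm_exp_I_mul_sub_exp_I_mul_le k r s
  set u := Complex.exp (Complex.I * (k : ℂ) * (r : ℂ))
  set v := Complex.exp (Complex.I * (k : ℂ) * (s : ℂ))
  have hsplit : u / (r : ℂ) - v / (s : ℂ)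
      = u * (((s - r) / (r * s) : ℝ) : ℂ) + (u - v) / (s : ℂ) := by
    push_cast
    field_simp
    ring
  calc ‖u / (r : ℂ) - v / (s : ℂ)‖
      ≤ ‖u * (((s - r) / (r * s) : ℝ) : ℂ)‖ + ‖(u - v) / (s : ℂ)‖ := by
        rw [hsplit]
        exact norm_add_le _ _
    _ = |r - s| / (r * s) + ‖u - v‖ / s := by
        rw [norm_mul, hunit, one_mul, norm_div, Complex.norm_real, Complex.norm_real,
          Real.norm_eq_abs, Real.norm_eq_abs, abs_div, abs_of_pos (mul_pos hr hs),
          abs_of_pos hs, abs_sub_comm]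
    _ ≤ |r - s| / (r * s) + |k| * |r - s| / s := by gcongr
    _ = |r - s| * (1 / (r * s) + |k| / s) := by ring

/-- let `k ≥ 0`, `d > 0`, `a > 0` with `a ≤ d/2`, and let `x, y, z ∈ ℝ³`
satisfy `|x−z| ≥ d` and `|y−z| ≤ a`.  Then
`|g(x,y) − g(x,z)| ≤ a·(2/d² + k/d)/(2π)`, so replacing `g(x,t)` by `g(x,x_m)` for `t`
on a small body of radius `a` with center `x_m` at distance `≥ d` from `x` produces an
error of order `O(a·max(1/d², k/d))`. -/
theorem g_center_approximation_error (k d a : ℝ) (hk : 0 ≤ k) (hd : 0 < d) (ha : 0 < a)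
    (had : a ≤ d / 2) (x y z : R3) (hxz : d ≤ ‖x - z‖) (hyz : ‖y - z‖ ≤ a) :
    ‖g k x y - g k x z‖ ≤ a * (2 / d ^ 2 + k / d) / (2 * Real.pi) := by
  have hdiff : |‖x - y‖ - ‖x - z‖| ≤ a := by
    refine (abs_norm_sub_norm_le _ _).trans ?_
    rwa [sub_sub_sub_cancel_left, norm_sub_rev]
  have hr : d / 2 ≤ ‖x - y‖ := by linarith [(abs_le.mp hdiff).1]
  have hr0 : 0 < ‖x - y‖ := by linarith
  have hs0 : 0 < ‖x - z‖ := by linarith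
  have hfactor : g k x y - g k x z =
      (Complex.exp (Complex.I * (k : ℂ) * (‖x - y‖ : ℂ)) / (‖x - y‖ : ℂ)
        - Complex.exp (Complex.I * (k : ℂ) * (‖x - z‖ : ℂ)) / (‖x - z‖ : ℂ))
        / ((4 * Real.pi : ℝ) : ℂ) := by
    unfold g
    push_cast
    rw [sub_div, div_div, div_div, mul_comm (‖x - y‖ : ℂ), mul_comm (‖x - z‖ : ℂ)]
  rw [hfactor, norm_div, Complex.norm_real, Real.norm_of_nonneg (by positivity)]
  calc _ ≤ |‖x - y‖ - ‖x - z‖| * (1 / (‖x - y‖ * ‖x - z‖) + |k| / ‖x - z‖) / (4 * Real.pi) := by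
        gcongr
        exact norm_exp_div_sub_exp_div_le k hr0 hs0
    _ ≤ a * (1 / (d / 2 * d) + k / d) / (4 * Real.pi) := by
        rw [abs_of_nonneg hk]
        gcongr
    _ = a * (2 / d ^ 2 + k / d) / (4 * Real.pi) := by
        congr 3
        field_simp
    _ ≤ a * (2 / d ^ 2 + k / d) / (2 * Real.pi) := by
        gcongr
        norm_num
end
end
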